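/- Let Ω = {y ∈ ℝ³ : y₂² + y₃² < 1, −1 < y₁ < 0} and, for each natural number j ≥ 1, let z_j = (1/j, 0, 0). Then for all j ≥ 1, ∫_Ω (−y₁) / (|y|³ · |y − z_j|) dy ≥ π · ( ln j + ln(1 + 1/j) + 1/(j+1) − 1 ) − π, where |·| is the Euclidean norm on ℝ³. -/

import Mathlib

open MeasureTheory

/-- The open solid cylinder `Ω = {y ∈ ℝ³ : y₂² + y₃² < 1, −1 < y₁ < 0}`. -/
def cylOmega : Set (EuclideanSpace ℝ (Fin 3)) :=
  {y | (y 1) ^ 2 + (y 2) ^ 2 < 1 ∧ -1 < y 0 ∧ y 0 < 0}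

/-- The singular point `z_j = (1/j, 0, 0)`. -/
noncomputable def zpt (j : ℕ) : EuclideanSpace ℝ (Fin 3) :=
  EuclideanSpace.single 0 (1 / (j : ℝ))

noncomputable def splitE : EuclideanSpace ℝ (Fin 3) ≃ᵐ ℝ × EuclideanSpace ℝ (Fin 2) :=
  ((MeasurableEquiv.toLp 2 (Fin 3 → ℝ)).symm.trans
    (MeasurableEquiv.piFinSuccAbove (fun _ => ℝ) 0)).trans
    (MeasurableEquiv.prodCongr (MeasurableEquiv.refl ℝ) (MeasurableEquiv.toLp 2 (Fin 2 → ℝ)))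

lemma splitE_fst (y : EuclideanSpace ℝ (Fin 3)) : (splitE y).1 = y 0 := rfl

lemma splitE_snd (y : EuclideanSpace ℝ (Fin 3)) :
    ‖(splitE y).2‖ ^ 2 = (y 1) ^ 2 + (y 2) ^ 2 := by
  rw [EuclideanSpace.norm_sq_eq, Fin.sum_univ_two, Real.norm_eq_abs, Real.norm_eq_abs, sq_abs,
    sq_abs]
  rfl

lemma splitE_mp : MeasurePreserving splitE volume volume := by
  have h1 := (PiLp.volume_preserving_toLp (Fin 3)).symm (MeasurableEquiv.toLp 2 (Fin 3 → ℝ))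
  have h2 := volume_preserving_piFinSuccAbove (fun _ : Fin 3 => ℝ) 0
  have h3 := (MeasurePreserving.id (volume : Measure ℝ)).prod (PiLp.volume_preserving_toLp (Fin 2))
  exact h3.comp (h2.comp h1)

lemma normsq3 (y : EuclideanSpace ℝ (Fin 3)) :
    ‖y‖ ^ 2 = (y 0) ^ 2 + (y 1) ^ 2 + (y 2) ^ 2 := by
  rw [EuclideanSpace.norm_sq_eq, Fin.sum_univ_three]
  simp only [Real.norm_eq_abs, sq_abs]

lemma normsq3z (y : EuclideanSpace ℝ (Fin 3)) (j : ℕ) :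
    ‖y - zpt j‖ ^ 2 = (1 / (j : ℝ) - y 0) ^ 2 + ((y 1) ^ 2 + (y 2) ^ 2) := by
  rw [normsq3]
  simp [zpt]
  ring

lemma meas_cyl : MeasurableSet cylOmega := by
  have h0 : Continuous fun y : EuclideanSpace ℝ (Fin 3) => y 0 := by fun_prop
  have h1 : Continuous fun y : EuclideanSpace ℝ (Fin 3) => (y 1) ^ 2 + (y 2) ^ 2 := by fun_prop
  exact ((isOpen_lt h1 continuous_const).inter ((isOpen_lt continuous_const h0).inter
    (isOpen_lt h0 continuous_const))).measurableSet

lemma integ_main (j : ℕ) (hj : 1 ≤ j) :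
    IntegrableOn (fun y : EuclideanSpace ℝ (Fin 3) => (-(y 0)) / (‖y‖ ^ 3 * ‖y - zpt j‖))
      cylOmega := by
  have hj0 : (0 : ℝ) < j := by exact_mod_cast hj
  have hm : Measurable (fun y : EuclideanSpace ℝ (Fin 3) =>
      (-(y 0)) / (‖y‖ ^ 3 * ‖y - zpt j‖)) := by fun_prop
  have hli : LocallyIntegrable (cylOmega.indicator
      (fun y : EuclideanSpace ℝ (Fin 3) => (-(y 0)) / (‖y‖ ^ 3 * ‖y - zpt j‖))) := by
    refine locallyIntegrable_of_norm_le_rpow (C := (j : ℝ)) (α := 2) (by simp)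
      (by simp; norm_num) (Filter.Eventually.of_forall fun y => ?_)
      (hm.indicator meas_cyl).aestronglyMeasurable
    by_cases hy : y ∈ cylOmega
    · rw [Set.indicator_of_mem hy]
      obtain ⟨h1, h2, h3⟩ := hy
      have hz : 1 / (j : ℝ) ≤ ‖y - zpt j‖ := by
        apply le_of_sq_le_sq _ (norm_nonneg _)
        rw [normsq3z]
        have : 0 < 1 / (j : ℝ) := by positivity
        nlinarith [sq_nonneg (y 1), sq_nonneg (y 2)]
      have hy0 : - y 0 ≤ ‖y‖ := by
        apply le_of_sq_le_sq _ (norm_nonneg _)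
        rw [normsq3]
        nlinarith [sq_nonneg (y 1), sq_nonneg (y 2)]
      have hyp : 0 < ‖y‖ := by linarith
      have hzp : 0 < ‖y - zpt j‖ := lt_of_lt_of_le (by positivity) hz
      rw [Real.norm_of_nonneg (by apply div_nonneg; linarith; positivity),
        Real.rpow_neg hyp.le, Real.rpow_two, div_le_iff₀ (by positivity)]
      have : 1 ≤ (j : ℝ) * ‖y - zpt j‖ := by
        rw [div_le_iff₀ hj0] at hz; linarith
      calc -y 0 ≤ ‖y‖ * 1 := by linarith
        _ ≤ ‖y‖ * ((j : ℝ) * ‖y - zpt j‖) := by gcongr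
        _ = _ := by field_simp
    · rw [Set.indicator_of_notMem hy]
      simp
      positivity
  have := (hli.integrableOn_isCompact (isCompact_closedBall (0 : EuclideanSpace ℝ (Fin 3)) 2)).mono_set
    (s := cylOmega) (by
      intro y ⟨h1, h2, h3⟩
      rw [mem_closedBall_zero_iff]
      apply le_of_sq_le_sq _ (by norm_num)
      rw [normsq3]
      nlinarith)
  exact this.congr_fun (fun y hy => Set.indicator_of_mem hy _) meas_cyl

lemma inner_int (c : ℝ) (hc : 0 < c) :
    ∫ x : EuclideanSpace ℝ (Fin 2), (Set.Iio (1 : ℝ)).indicator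
      (fun r => 1 / (c ^ 2 + r ^ 2) ^ 2) ‖x‖ = Real.pi * (1 / c ^ 2 - 1 / (c ^ 2 + 1)) := by
  rw [integral_fun_norm_addHaar volume ((Set.Iio (1 : ℝ)).indicator
      (fun r => 1 / (c ^ 2 + r ^ 2) ^ 2))]
  have h1 : ∫ y in Set.Ioi (0 : ℝ), y ^ (Module.finrank ℝ (EuclideanSpace ℝ (Fin 2)) - 1) •
      (Set.Iio (1 : ℝ)).indicator (fun r => 1 / (c ^ 2 + r ^ 2) ^ 2) y
      = ∫ y in (0 : ℝ)..1, y / (c ^ 2 + y ^ 2) ^ 2 := by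
    rw [intervalIntegral.integral_of_le zero_le_one, integral_Ioc_eq_integral_Ioo,
      ← Set.Ioi_inter_Iio, ← setIntegral_indicator measurableSet_Iio]
    congr 1
    ext y
    by_cases hy : y ∈ Set.Iio (1 : ℝ)
    · simp [Set.indicator_of_mem hy]; rfl
    · simp [Set.indicator_of_notMem hy]
  have hpos : ∀ y : ℝ, c ^ 2 + y ^ 2 ≠ 0 := fun y => by positivity
  have h2 : ∫ y in (0 : ℝ)..1, y / (c ^ 2 + y ^ 2) ^ 2
      = -(1 / 2) * (c ^ 2 + 1 ^ 2)⁻¹ - -(1 / 2) * (c ^ 2 + 0 ^ 2)⁻¹ := by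
    apply intervalIntegral.integral_eq_sub_of_hasDerivAt
      (f := fun y : ℝ => -(1 / 2) * (c ^ 2 + y ^ 2)⁻¹)
    · intro y _
      have := ((((hasDerivAt_id y).pow 2).const_add (c ^ 2)).inv (hpos y)).const_mul (-(1 / 2) : ℝ)
      refine this.congr_deriv ?_
      have := hpos y
      simp only [id, Nat.cast_ofNat, Pi.pow_apply]
      field_simp
      try ring
    · apply Continuous.intervalIntegrable
      exact continuous_id.div (by fun_prop) (fun y => pow_ne_zero 2 (hpos y))
  rw [h1, h2]
  have h3 : volume.real (Metric.ball (0 : EuclideanSpace ℝ (Fin 2)) 1) = Real.pi := by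
    simp [Measure.real, EuclideanSpace.volume_ball_fin_two, Real.pi_nonneg]
  rw [h3]
  simp
  ring

lemma outer_int (a : ℝ) (ha : 0 < a) :
    Real.pi * (Real.log (1 + a) - Real.log a + a / (1 + a) - 1) - Real.pi ≤
    ∫ s in Set.Ioo (-1 : ℝ) 0, (-s) * (Real.pi * (1 / (a - s) ^ 2 - 1 / ((a - s) ^ 2 + 1))) := by
  rw [← integral_Ioc_eq_integral_Ioo, ← intervalIntegral.integral_of_le (by norm_num)]
  have hne : ∀ s ∈ Set.uIcc (-1 : ℝ) 0, a - s ≠ 0 := by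
    intro s hs
    rw [Set.uIcc_of_le (by norm_num)] at hs
    have := hs.2
    linarith
  have hi1 : IntervalIntegrable (fun s : ℝ => (-s) * (Real.pi * (1 / (a - s) ^ 2))) volume (-1) 0 := by
    apply ContinuousOn.intervalIntegrable
    refine ContinuousOn.mul (by fun_prop) (ContinuousOn.mul (by fun_prop) (ContinuousOn.div (by fun_prop) (by fun_prop) ?_))
    intro s hs
    exact pow_ne_zero 2 (hne s hs)
  have hi2 : IntervalIntegrable (fun s : ℝ => (-s) * (Real.pi * (1 / ((a - s) ^ 2 + 1)))) volume (-1) 0 := by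
    apply Continuous.intervalIntegrable
    refine Continuous.mul (by fun_prop) (Continuous.mul (by fun_prop) (Continuous.div (by fun_prop) (by fun_prop) ?_))
    intro s
    positivity
  have e1 : ∫ s in (-1 : ℝ)..0, (-s) * (Real.pi * (1 / (a - s) ^ 2)) =
      -Real.pi * (Real.log (a - 0) + a * (a - 0)⁻¹) -
      -Real.pi * (Real.log (a - (-1)) + a * (a - (-1))⁻¹) := by
    apply intervalIntegral.integral_eq_sub_of_hasDerivAt
      (f := fun s : ℝ => -Real.pi * (Real.log (a - s) + a * (a - s)⁻¹))
    · intro s hs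
      have h0 := (hasDerivAt_id s).const_sub a
      have := ((h0.log (hne s hs)).add ((h0.inv (hne s hs)).const_mul a)).const_mul (-Real.pi)
      refine this.congr_deriv ?_
      have := hne s hs
      simp only [id]
      field_simp
      ring
    · exact hi1
  have e2 : ∫ s in (-1 : ℝ)..0, (-s) * (Real.pi * (1 / ((a - s) ^ 2 + 1))) ≤ Real.pi := by
    have : ∫ s in (-1 : ℝ)..0, (-s) * (Real.pi * (1 / ((a - s) ^ 2 + 1))) ≤
        ∫ s in (-1 : ℝ)..0, Real.pi := by
      apply intervalIntegral.integral_mono_on (by norm_num) hi2 (by simp)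
      intro s hs
      have h1 : 1 / ((a - s) ^ 2 + 1) ≤ 1 := by
        rw [div_le_one (by positivity)]
        nlinarith [sq_nonneg (a - s)]
      calc (-s) * (Real.pi * (1 / ((a - s) ^ 2 + 1))) ≤ 1 * (Real.pi * 1) := by
            gcongr
            linarith [hs.1]
        _ = _ := by ring
    simpa using this
  have e3 : ∫ s in (-1 : ℝ)..0, (-s) * (Real.pi * (1 / (a - s) ^ 2 - 1 / ((a - s) ^ 2 + 1))) =
      (∫ s in (-1 : ℝ)..0, (-s) * (Real.pi * (1 / (a - s) ^ 2))) -
      ∫ s in (-1 : ℝ)..0, (-s) * (Real.pi * (1 / ((a - s) ^ 2 + 1))) := by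
    rw [← intervalIntegral.integral_sub hi1 hi2]
    congr 1
    ext s
    ring
  rw [e3, e1]
  have : a * (a - 0)⁻¹ = 1 := by rw [sub_zero]; exact mul_inv_cancel₀ ha.ne'
  rw [this, sub_zero, sub_neg_eq_add, add_comm a 1, ← div_eq_mul_inv]
  linarith

lemma main_bound (j : ℕ) (hj : 1 ≤ j) :
    ∫ s in Set.Ioo (-1 : ℝ) 0, (-s) * (Real.pi * (1 / (1 / (j : ℝ) - s) ^ 2 -
      1 / ((1 / (j : ℝ) - s) ^ 2 + 1))) ≤
    ∫ y in cylOmega, (-(y 0)) / (‖y‖ ^ 3 * ‖y - zpt j‖) := by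
  have hj0 : (0 : ℝ) < j := by exact_mod_cast hj
  have ha : 0 < 1 / (j : ℝ) := by positivity
  set F : EuclideanSpace ℝ (Fin 3) → ℝ := fun y => (-(y 0)) / (‖y - zpt j‖ ^ 2) ^ 2 with hF
  have hFm : Measurable F := by fun_prop
  have hle : ∀ y ∈ cylOmega, 0 ≤ F y ∧ F y ≤ (-(y 0)) / (‖y‖ ^ 3 * ‖y - zpt j‖) := by
    intro y ⟨h1, h2, h3⟩
    have hyp : 0 < ‖y‖ := by
      rw [norm_pos_iff]
      rintro rfl
      simp at h3
    have hyz : ‖y‖ ≤ ‖y - zpt j‖ := by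
      apply le_of_sq_le_sq _ (norm_nonneg _)
      rw [normsq3z, normsq3]
      nlinarith
    have : 0 ≤ - y 0 := by linarith
    refine ⟨by positivity, ?_⟩
    simp only [hF]
    apply div_le_div_of_nonneg_left this (mul_pos (by positivity) (hyp.trans_le hyz))
    calc ‖y‖ ^ 3 * ‖y - zpt j‖ ≤ ‖y - zpt j‖ ^ 3 * ‖y - zpt j‖ := by gcongr
      _ = _ := by ring
  have hFi : IntegrableOn F cylOmega := by
    refine Integrable.mono' (integ_main j hj) hFm.aestronglyMeasurable ?_
    refine (ae_restrict_iff' meas_cyl).2 (Filter.Eventually.of_forall fun y hy => ?_)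
    rw [Real.norm_of_nonneg (hle y hy).1]
    exact (hle y hy).2
  refine le_trans (le_of_eq ?_) (setIntegral_mono_on hFi (integ_main j hj) meas_cyl
    fun y hy => (hle y hy).2)
  set G : ℝ × EuclideanSpace ℝ (Fin 2) → ℝ := fun p =>
    (Set.Ioo (-1 : ℝ) 0).indicator (fun s => -s) p.1 *
      (Set.Iio (1 : ℝ)).indicator (fun r => 1 / ((1 / (j : ℝ) - p.1) ^ 2 + r ^ 2) ^ 2) ‖p.2‖ with hG
  have hGF : ∀ y, cylOmega.indicator F y = G (splitE y) := by
    intro y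
    have hs := splitE_snd y
    have hiff : ‖(splitE y).2‖ < 1 ↔ (y 1) ^ 2 + (y 2) ^ 2 < 1 := by
      rw [← hs, sq_lt_one_iff₀ (norm_nonneg _)]
    simp only [hG]
    rw [splitE_fst]
    by_cases hy : y ∈ cylOmega
    · rw [Set.indicator_of_mem hy, Set.indicator_of_mem (Set.mem_Ioo.2 hy.2),
        Set.indicator_of_mem (Set.mem_Iio.2 (hiff.2 hy.1)), hs]
      simp only [hF]
      rw [normsq3z]
      ring
    · rw [Set.indicator_of_notMem hy]
      by_cases h1 : (y 1) ^ 2 + (y 2) ^ 2 < 1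
      · rw [Set.indicator_of_notMem (s := Set.Ioo (-1 : ℝ) 0) (fun h => hy ⟨h1, h⟩), zero_mul]
      · rw [Set.indicator_of_notMem (s := Set.Iio (1 : ℝ)) (fun h => h1 (hiff.1 h)), mul_zero]
  have hGi : Integrable G := by
    rw [← splitE_mp.integrable_comp_emb splitE.measurableEmbedding]
    have := (integrable_indicator_iff meas_cyl).2 hFi
    rwa [show cylOmega.indicator F = G ∘ splitE from funext hGF] at this
  rw [← integral_indicator meas_cyl, integral_congr_ae (Filter.Eventually.of_forall hGF),
    splitE_mp.integral_comp', Measure.volume_eq_prod, integral_prod _ hGi,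
    ← integral_indicator measurableSet_Ioo]
  congr 1
  ext s
  simp only [hG]
  rw [integral_const_mul]
  by_cases hs : s ∈ Set.Ioo (-1 : ℝ) 0
  · rw [Set.indicator_of_mem hs, Set.indicator_of_mem hs, inner_int _ (by linarith [hs.2])]
  · rw [Set.indicator_of_notMem hs, Set.indicator_of_notMem hs, zero_mul]

theorem integral_lower_bound (j : ℕ) (hj : 1 ≤ j) :
    (∫ y in cylOmega, (-(y 0)) / (‖y‖ ^ 3 * ‖y - zpt j‖)) ≥
      Real.pi * (Real.log j + Real.log (1 + 1 / (j : ℝ)) + 1 / ((j : ℝ) + 1) - 1) - Real.pi := by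
  have hj0 : (0 : ℝ) < j := by exact_mod_cast hj
  have h := (outer_int (1 / (j : ℝ)) (by positivity)).trans (main_bound j hj)
  refine le_trans (le_of_eq ?_) h
  have h1 : (1 / (j : ℝ)) / (1 + 1 / (j : ℝ)) = 1 / ((j : ℝ) + 1) := by field_simp
  have h2 : Real.log (1 / (j : ℝ)) = - Real.log j := by rw [one_div, Real.log_inv]
  rw [h1, h2]
  ring
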